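/- Let μ be a finite measure on a measurable space S, U measurable, g bounded measurable with g > 0 on U and g ≥ 0 on S. If ν is any measure with ν ≤ μ and ν(S \ U) = 0 and ∫ g dν = ∫_U g dμ, then ν = μ|_U on all measurable subsets of U, i.e., the maximizer of Theorem 1 is unique. -/

import Mathlib

open MeasureTheory

/-- Uniqueness of the maximizer in Theorem 1: any feasible `ν` attaining the optimal value
`∫_U g dμ` agrees with `μ|_U` on all measurable subsets of `U`. -/
theorem restrict_maximizer_unique {S : Type*} [MeasurableSpace S]
    (μ : Measure S) [IsFiniteMeasure μ] (U : Set S) (hU : MeasurableSet U)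
    (g : S → ℝ) (hg : Measurable g) (C : ℝ) (hbd : ∀ s, |g s| ≤ C)
    (hpos : ∀ s ∈ U, 0 < g s) (hnn : ∀ s, 0 ≤ g s)
    (ν : Measure S) (hle : ∀ A : Set S, MeasurableSet A → ν A ≤ μ A)
    (hsupp : ν Uᶜ = 0) (hopt : ∫ s, g s ∂ν = ∫ s in U, g s ∂μ) :
    ∀ A : Set S, MeasurableSet A → A ⊆ U → ν A = μ.restrict U A := by
  intro A _ hAU
  have hνμ : ν ≤ μ := Measure.le_iff.2 hle
  have hνU : ν.restrict U = ν := Measure.restrict_eq_self_of_ae_mem (mem_ae_iff.2 hsupp)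
  have hνm : ν ≤ μ.restrict U := by
    rw [← hνU]
    exact Measure.restrict_mono le_rfl hνμ
  haveI : IsFiniteMeasure ν := isFiniteMeasure_of_le μ hνμ
  obtain ⟨ρ, hρ⟩ : ∃ ρ : Measure S, ρ + ν = μ.restrict U :=
    ⟨μ.restrict U - ν, Measure.sub_add_cancel_of_le hνm⟩
  have hρm : ρ ≤ μ.restrict U := by
    rw [← hρ]
    exact Measure.le_add_right le_rfl
  haveI : IsFiniteMeasure ρ := isFiniteMeasure_of_le _ hρm
  have hint : ∀ (m : Measure S) [IsFiniteMeasure m], Integrable g m := fun m _ =>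
    Integrable.of_bound hg.aestronglyMeasurable C (Filter.Eventually.of_forall hbd)
  have h0 : ∫ s, g s ∂ρ = 0 := by
    have h := integral_add_measure (hint ρ) (hint ν)
    rw [hρ] at h
    linarith
  have hae : g =ᵐ[ρ] 0 := (integral_eq_zero_iff_of_nonneg hnn (hint ρ)).1 h0
  have hρA : ρ A = 0 := by
    refine measure_mono_null (fun s hs => ?_) (mem_ae_iff.1 hae)
    exact (hpos s (hAU hs)).ne'
  rw [← hρ, Measure.add_apply, hρA, zero_add]
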